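/- arXiv:2312.08312 — 2 statements merged into one kernel-verified Lean document; each statement's English description precedes it below -/
import Mathlib

section
/- With the Hahn/dual-Hahn Tratnik functions T_{i,j}(x,y) as defined, set B(x,y) = (y−N+x)(y+1+ρ)(y+1+σ+x) / [ (2y+σ+x+1)(2y+σ+x+2) ], C(x,y) = −y(y+N+σ+1)(y+σ+x−ρ) / [ (2y+σ+x)(2y+σ+x+1) ], and A(x,y) = −B(x,y) − C(x,y). Then for all (i,j) ∈ D and (x,y) ∈ D the following three-term difference relation holds: j · T_{i,j}(x,y) = B(x,y) · T_{i,j}(x,y+1) + A(x,y) · T_{i,j}(x,y) + C(x,y) · T_{i,j}(x,y−1), with the conventions that the term involving T_{i,j}(x,y+1) is omitted when y = N − x (its coefficient B(x,N−x) vanishes) and the term involving T_{i,j}(x,y−1) is omitted when y = 0 (its coefficient C(x,0) vanishes). -/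
/-- Pochhammer symbol `(a)_k = a (a+1) ⋯ (a+k-1)`. -/
noncomputable def poch (a : ℂ) (k : ℕ) : ℂ := ∏ l ∈ Finset.range k, (a + l)

/-- The hypergeometric-type sum `h(i,j,x)` entering the Hahn part. -/
noncomputable def hSum (N : ℕ) (r s : ℂ) (i j x : ℕ) : ℂ :=
  ∑ k ∈ Finset.range (min i x + 1),
    poch (-(i : ℂ)) k * poch ((i : ℂ) + 1 + s + j) k * poch (-(x : ℂ)) k /
      (poch (r + 1) k * poch (-(N : ℂ) + j) k * (k.factorial : ℂ))

/-- The hypergeometric-type sum `h'(j,x,y)` entering the dual Hahn part. -/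
noncomputable def hSum' (N : ℕ) (ρ σ : ℂ) (j x y : ℕ) : ℂ :=
  ∑ k ∈ Finset.range (min j y + 1),
    poch (-(j : ℂ)) k * poch (-(y : ℂ)) k * poch ((y : ℂ) + 1 + σ + x) k /
      (poch (ρ + 1) k * poch (-(N : ℂ) + x) k * (k.factorial : ℂ))

/-- The Hahn / dual Hahn Tratnik function `T_{i,j}(x,y)`. -/
noncomputable def tratnikT (N : ℕ) (r s ρ σ : ℂ) (i j x y : ℕ) : ℂ :=
  ((N - j).choose i : ℂ) * ((N - x).choose j : ℂ) * (-1 : ℂ) ^ j * poch (r + 1) i *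
      poch (2 + s + j) (N - j) * poch (ρ + 1) j /
      (poch (s + j - r + 1) i * poch (s + j + 1 + i) i * poch (s + j + 2 * i + 2) (N - j - i) *
        poch (ρ - σ - N) j) *
    hSum N r s i j x * hSum' N ρ σ j x y

/-- The weight function `F(x,y)`. -/
noncomputable def wF (N : ℕ) (r s ρ σ : ℂ) (x y : ℕ) : ℂ :=
  (N.factorial : ℂ) / ((x.factorial : ℂ) * (y.factorial : ℂ) * ((N - x - y).factorial : ℂ)) *
    ((-1 : ℂ) ^ (N - y) * poch (r + 1) x * poch (ρ + 1) y * poch (ρ - N - σ) (N - x - y)) /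
    (poch (σ + x + y + 1) y * poch (σ + x + 2 * y + 2) (N - x - y) * poch (r - s - N) x)

/-- The weight function `G(i,j)`. -/
noncomputable def wG (N : ℕ) (r s ρ σ : ℂ) (i j : ℕ) : ℂ :=
  (N.factorial : ℂ) / ((i.factorial : ℂ) * (j.factorial : ℂ) * ((N - i - j).factorial : ℂ)) *
    (poch (r + 1) i * (poch (2 + s + j) (N - j)) ^ 2 * poch (ρ + 1) j) /
    (poch (s + j - r + 1) i * poch (s + j + 1 + i) i * poch (s + j + 2 * i + 2) (N - j - i) *
      poch (ρ - σ - N) j * poch (r - s - N) (N - j))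

/-- Coefficient `B(x,y)` of the difference relation. -/
noncomputable def coeffB (N : ℕ) (ρ σ : ℂ) (x y : ℕ) : ℂ :=
  ((y : ℂ) - N + x) * ((y : ℂ) + 1 + ρ) * ((y : ℂ) + 1 + σ + x) /
    ((2 * (y : ℂ) + σ + x + 1) * (2 * (y : ℂ) + σ + x + 2))

/-- Coefficient `C(x,y)` of the difference relation. -/
noncomputable def coeffC (N : ℕ) (ρ σ : ℂ) (x y : ℕ) : ℂ :=
  -((y : ℂ) * ((y : ℂ) + N + σ + 1) * ((y : ℂ) + σ + x - ρ)) /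
    ((2 * (y : ℂ) + σ + x) * (2 * (y : ℂ) + σ + x + 1))

theorem poch_zero (a : ℂ) : poch a 0 = 1 := by simp [poch]

theorem poch_succ (a : ℂ) (k : ℕ) : poch a (k + 1) = poch a k * (a + k) := by
  simp [poch, Finset.prod_range_succ]

theorem poch_succ_left (a : ℂ) (k : ℕ) : poch a (k + 1) = a * poch (a + 1) k := by
  rw [poch, Finset.prod_range_succ', mul_comm]
  simp [poch, add_assoc, add_comm (1 : ℂ)]

theorem poch_neg_natCast_eq_zero {y k : ℕ} (h : y < k) : poch (-(y : ℂ)) k = 0 :=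
  Finset.prod_eq_zero (Finset.mem_range.2 h) (by simp)

/-- The quadratic-lattice basis `(-z)_k (z + 1 + a)_k` of the dual Hahn polynomials. -/
noncomputable def dualHahnBasis (a z : ℂ) (k : ℕ) : ℂ := poch (-z) k * poch (z + 1 + a) k

/-- The coefficient of `dualHahnBasis` in the dual Hahn polynomial of degree `j`. -/
noncomputable def dualHahnCoeff (M ρ : ℂ) (j k : ℕ) : ℂ :=
  poch (-(j : ℂ)) k / (poch (ρ + 1) k * poch (-M) k * (k.factorial : ℂ))

/-- The dual Hahn polynomial of degree `j` at a complex argument. -/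
noncomputable def dualHahn (M ρ a : ℂ) (j : ℕ) (z : ℂ) : ℂ :=
  ∑ k ∈ Finset.range (j + 1), dualHahnCoeff M ρ j k * dualHahnBasis a z k

theorem hSum'_eq_dualHahn (N : ℕ) (ρ σ : ℂ) (j x y : ℕ) :
    hSum' N ρ σ j x y = dualHahn (N - x) ρ (σ + x) j y := by
  have hterm : ∀ k, poch (-(j : ℂ)) k * poch (-(y : ℂ)) k * poch ((y : ℂ) + 1 + σ + x) k /
      (poch (ρ + 1) k * poch (-(N : ℂ) + x) k * (k.factorial : ℂ)) =
      dualHahnCoeff (N - x) ρ j k * dualHahnBasis (σ + x) y k := by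
    intro k
    rw [dualHahnCoeff, dualHahnBasis, neg_sub, neg_add_eq_sub, ← add_assoc]
    ring
  rw [hSum', dualHahn, Finset.sum_congr rfl fun k _ => hterm k]
  refine Finset.sum_subset (fun k hk => ?_) fun k hk hk' => ?_
  · simp only [Finset.mem_range] at hk ⊢
    omega
  · simp only [Finset.mem_range] at hk hk'
    rw [dualHahnBasis, poch_neg_natCast_eq_zero (by omega), zero_mul, mul_zero]

/-- The difference operator is lower bidiagonal in `dualHahnBasis`. -/
theorem dualHahnBasis_difference (M ρ a z : ℂ) (n : ℕ) (h1 : 2 * z + a + 1 ≠ 0)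
    (h2 : 2 * z + a + 2 ≠ 0) (h0 : z = 0 ∨ 2 * z + a ≠ 0) :
    (z - M) * (z + 1 + ρ) * (z + 1 + a) / ((2 * z + a + 1) * (2 * z + a + 2)) *
        (dualHahnBasis a (z + 1) (n + 1) - dualHahnBasis a z (n + 1)) +
      -(z * (z + M + a + 1) * (z + a - ρ)) / ((2 * z + a) * (2 * z + a + 1)) *
        (dualHahnBasis a (z - 1) (n + 1) - dualHahnBasis a z (n + 1)) =
    (n + 1) * dualHahnBasis a z (n + 1) -
      (n + 1) * (ρ + n + 1) * (-M + n) * dualHahnBasis a z n := by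
  have e1 : poch (-(z + 1)) (n + 1) = (-z - 1) * poch (-z) n := by
    rw [poch_succ_left]; ring_nf
  have e2 : (z + 1 + a) * poch (z + 1 + 1 + a) (n + 1) =
      poch (z + 1 + a) n * (z + 1 + a + n) * (z + 2 + a + n) := by
    have h := poch_succ_left (z + 1 + a) (n + 1)
    rw [poch_succ, poch_succ, show z + 1 + a + 1 = z + 1 + 1 + a by ring] at h
    rw [← h]; push_cast; ring
  have e3 : z * poch (-(z - 1)) (n + 1) = -(poch (-z) n * (-z + n) * (-z + n + 1)) := by
    have h := poch_succ_left (-z) (n + 1)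
    rw [poch_succ, poch_succ, show -z + 1 = -(z - 1) by ring] at h
    push_cast at h
    linear_combination h
  have e4 : poch (z - 1 + 1 + a) (n + 1) = (z + a) * poch (z + 1 + a) n := by
    rw [poch_succ_left]; ring_nf
  have e5 : z = 0 → poch (-z) n * n = 0 := by
    rintro rfl
    cases n with
    | zero => simp
    | succ n => simp [poch_succ_left]
  simp only [dualHahnBasis, e1, e4]
  rw [poch_succ (-z), poch_succ (z + 1 + a)]
  generalize poch (z + 1 + 1 + a) (n + 1) = U at *
  generalize poch (-(z - 1)) (n + 1) = V at *
  generalize poch (-z) n = X at *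
  generalize poch (z + 1 + a) n = Y at *
  have hB : (z - M) * (z + 1 + ρ) * (z + 1 + a) / ((2 * z + a + 1) * (2 * z + a + 2)) *
        ((-z - 1) * X * U - X * (-z + n) * (Y * (z + 1 + a + n))) =
      -((z - M) * (z + 1 + ρ) * (n + 1)) * (X * Y) * (z + 1 + a + n) / (2 * z + a + 1) := by
    rw [div_mul_eq_mul_div, div_eq_div_iff (mul_ne_zero h1 h2) h1]
    linear_combination (z - M) * (z + 1 + ρ) * (-z - 1) * X * (2 * z + a + 1) * e2
  rw [hB]
  rcases eq_or_ne z 0 with hz | hz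
  · have hX := e5 hz
    subst hz
    simp only [zero_mul, neg_zero, zero_div, add_zero]
    rw [div_eq_iff h1]
    rcases mul_eq_zero.1 hX with h | h <;> rw [h] <;> ring
  · have h0 := h0.resolve_left hz
    have hC : -(z * (z + M + a + 1) * (z + a - ρ)) / ((2 * z + a) * (2 * z + a + 1)) *
          (V * ((z + a) * Y) - X * (-z + n) * (Y * (z + 1 + a + n))) =
        -((z + M + a + 1) * (z + a - ρ) * (n + 1)) * (X * Y) * (z - n) / (2 * z + a + 1) := by
      rw [div_mul_eq_mul_div, div_eq_div_iff (mul_ne_zero h0 h1) h1]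
      linear_combination (-(z + M + a + 1) * (z + a - ρ) * (z + a) * Y * (2 * z + a + 1)) * e3
    rw [hC, ← add_div, div_eq_iff h1]
    ring

theorem dualHahnCoeff_succ (M ρ : ℂ) (j k : ℕ) (hρ : ρ + k + 1 ≠ 0) (hM : -M + k ≠ 0) :
    dualHahnCoeff M ρ j (k + 1) * ((k + 1) * (ρ + k + 1) * (-M + k)) =
      (k - j) * dualHahnCoeff M ρ j k := by
  have hk : (k : ℂ) + 1 ≠ 0 := Nat.cast_add_one_ne_zero k
  have hρ' : ρ + 1 + k ≠ 0 := by rwa [add_right_comm]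
  simp only [dualHahnCoeff, poch_succ, Nat.factorial_succ]
  push_cast
  rw [show ρ + k + 1 = ρ + 1 + k by ring]
  rw [div_mul_eq_mul_div, show poch (-(j : ℂ)) k * (-j + k) * ((k + 1) * (ρ + 1 + k) * (-M + k)) =
    ((k - j) * poch (-(j : ℂ)) k) * ((k + 1) * (ρ + 1 + k) * (-M + k)) by ring,
    show poch (ρ + 1) k * (ρ + 1 + k) * (poch (-M) k * (-M + k)) * ((k + 1) * k.factorial) =
    (poch (ρ + 1) k * poch (-M) k * k.factorial) * ((k + 1) * (ρ + 1 + k) * (-M + k)) by ring,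
    mul_div_mul_right _ _ (mul_ne_zero (mul_ne_zero hk hρ') hM), mul_div_assoc]

/-- The difference equation of the dual Hahn polynomials. -/
theorem dualHahn_difference (M ρ a z : ℂ) (j : ℕ) (h1 : 2 * z + a + 1 ≠ 0)
    (h2 : 2 * z + a + 2 ≠ 0) (h0 : z = 0 ∨ 2 * z + a ≠ 0)
    (hρ : ∀ k < j, ρ + k + 1 ≠ 0) (hM : ∀ k < j, -M + k ≠ 0) :
    (z - M) * (z + 1 + ρ) * (z + 1 + a) / ((2 * z + a + 1) * (2 * z + a + 2)) *
        (dualHahn M ρ a j (z + 1) - dualHahn M ρ a j z) +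
      -(z * (z + M + a + 1) * (z + a - ρ)) / ((2 * z + a) * (2 * z + a + 1)) *
        (dualHahn M ρ a j (z - 1) - dualHahn M ρ a j z) =
    j * dualHahn M ρ a j z := by
  simp only [dualHahn]
  rw [← Finset.sum_sub_distrib, ← Finset.sum_sub_distrib, Finset.mul_sum, Finset.mul_sum,
    ← Finset.sum_add_distrib, Finset.sum_range_succ']
  have hstep : ∀ k ∈ Finset.range j, _ = _ := fun k hk => by
    have hk := Finset.mem_range.1 hk
    exact (congrArg (dualHahnCoeff M ρ j (k + 1) * ·)
      (dualHahnBasis_difference M ρ a z k h1 h2 h0)).trans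
      (show _ = ((k + 1 : ℕ) * (dualHahnCoeff M ρ j (k + 1) * dualHahnBasis a z (k + 1)) -
          k * (dualHahnCoeff M ρ j k * dualHahnBasis a z k)) +
          j * (dualHahnCoeff M ρ j k * dualHahnBasis a z k) by
        push_cast
        linear_combination
          -dualHahnBasis a z k * dualHahnCoeff_succ M ρ j k (hρ k hk) (hM k hk))
  have hsum := Finset.sum_congr rfl hstep
  rw [Finset.sum_add_distrib, Finset.sum_range_sub
    (fun k : ℕ => (k : ℂ) * (dualHahnCoeff M ρ j k * dualHahnBasis a z k)),
    ← Finset.mul_sum] at hsum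
  rw [Finset.sum_range_succ]
  simp only [dualHahnBasis, poch_zero] at hsum ⊢
  simp only [Nat.cast_zero, zero_mul, sub_zero, sub_self, mul_zero, add_zero] at hsum ⊢
  exact (Finset.sum_congr rfl fun k _ => by ring).trans (hsum.trans (by ring))

theorem tratnik_difference_relation (N : ℕ) (hN : 0 < N) (r s ρ σ : ℂ)
    (hs : ∀ m : ℕ, 1 ≤ m → m ≤ 2 * N + 2 → s + (m : ℂ) ≠ 0)
    (hσ : ∀ m : ℕ, 1 ≤ m → m ≤ 2 * N + 2 → σ + (m : ℂ) ≠ 0)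
    (hr : ∀ m : ℕ, 1 ≤ m → m ≤ N + 1 → r + (m : ℂ) ≠ 0)
    (hρ : ∀ m : ℕ, 1 ≤ m → m ≤ N + 1 → ρ + (m : ℂ) ≠ 0)
    (hsr : ∀ m : ℕ, m ≤ 2 * N + 1 → s - r + (m : ℂ) ≠ 0)
    (hσρ : ∀ m : ℕ, m ≤ 2 * N + 1 → σ - ρ + (m : ℂ) ≠ 0)
    (i j x y : ℕ) (hij : i + j ≤ N) (hxy : x + y ≤ N) :
    (j : ℂ) * tratnikT N r s ρ σ i j x y =
      coeffB N ρ σ x y * tratnikT N r s ρ σ i j x (y + 1) +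
        (-coeffB N ρ σ x y - coeffC N ρ σ x y) * tratnikT N r s ρ σ i j x y +
        coeffC N ρ σ x y * tratnikT N r s ρ σ i j x (y - 1) := by

  rcases lt_or_ge (N - x) j with hj | hj
  · simp [tratnikT, Nat.choose_eq_zero_of_lt hj]
  have hfac : ∀ y' : ℕ, tratnikT N r s ρ σ i j x y' =
      tratnikT N r s ρ σ i j x 0 * dualHahn (N - x) ρ (σ + x) j y' := by
    intro y'
    have h0 : dualHahn (N - x) ρ (σ + x) j ((0 : ℕ) : ℂ) = 1 := by
      rw [← hSum'_eq_dualHahn]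
      simp [hSum', poch_zero]
    simp only [tratnikT, hSum'_eq_dualHahn, h0, mul_one]
  have key := dualHahn_difference (N - x) ρ (σ + x) y j ?_ ?_ ?_ ?_ ?_
  · rw [hfac y, hfac (y + 1), hfac (y - 1)]
    have hB : coeffB N ρ σ x y = (y - (N - x : ℂ)) * (y + 1 + ρ) * (y + 1 + (σ + x)) /
        ((2 * y + (σ + x) + 1) * (2 * y + (σ + x) + 2)) := by
      rw [coeffB]; ring_nf
    have hC : coeffC N ρ σ x y = -(y * (y + (N - x) + (σ + x) + 1) * (y + (σ + x) - ρ)) /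
        ((2 * y + (σ + x)) * (2 * y + (σ + x) + 1)) := by
      rw [coeffC]; ring_nf
    rw [← hB, ← hC] at key
    have hpred : coeffC N ρ σ x y * dualHahn (N - x) ρ (σ + x) j ((y - 1 : ℕ) : ℂ) =
        coeffC N ρ σ x y * dualHahn (N - x) ρ (σ + x) j (y - 1) := by
      cases y with
      | zero => simp [coeffC]
      | succ y => simp
    push_cast
    linear_combination (-tratnikT N r s ρ σ i j x 0) * (key + hpred)
  · have h := hσ (2 * y + x + 1) (by omega) (by omega)
    contrapose! h
    push_cast
    linear_combination h
  · have h := hσ (2 * y + x + 2) (by omega) (by omega)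
    contrapose! h
    push_cast
    linear_combination h
  · rcases Nat.eq_zero_or_pos y with rfl | hy
    · simp
    · have h := hσ (2 * y + x) (by omega) (by omega)
      right
      contrapose! h
      push_cast
      linear_combination h
  · intro k hk h
    refine hρ (k + 1) (by omega) (by omega) ?_
    push_cast
    linear_combination h
  · intro k hk h
    have h' : ((k + x : ℕ) : ℂ) = (N : ℕ) := by push_cast; linear_combination h
    have := Nat.cast_injective h'
    omega
end

section
/- With the q-Hahn/dual-q-Hahn Tratnik functions T_{i,j}(x,y) and the weight functions F(x,y) and G(i,j) as defined, for all (i,j) ∈ D and (i',j') ∈ D the following orthogonality relation holds: Σ_{x=0}^{min(N−j, N−j')} Σ_{y=0}^{N−x} F(x,y) · T_{i,j}(x,y) · T_{i',j'}(x,y) = δ_{i,i'} δ_{j,j'} · G(i,j), where δ denotes the Kronecker delta. -/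
/-- q-Pochhammer symbol `(a;q)_k`. -/
noncomputable def qpoch (a q : ℂ) (k : ℕ) : ℂ := ∏ l ∈ Finset.range k, (1 - a * q ^ l)

/-- q-binomial coefficient `[n choose i]_q` (set to `0` when `i > n`). -/
noncomputable def qbinom (q : ℂ) (n i : ℕ) : ℂ :=
  if i ≤ n then qpoch q q n / (qpoch q q i * qpoch q q (n - i)) else 0

/-- q-trinomial coefficient `[N choose i,j]_q`. -/
noncomputable def qtrinom (q : ℂ) (N i j : ℕ) : ℂ :=
  qpoch q q N / (qpoch q q i * qpoch q q j * qpoch q q (N - i - j))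

/-- The q-hypergeometric-type sum `φ(i,j,x)` entering the q-Hahn part. -/
noncomputable def qphi (N : ℕ) (q r s : ℂ) (i j x : ℕ) : ℂ :=
  ∑ k ∈ Finset.range (min i x + 1),
    qpoch (q ^ (-(i : ℤ))) q k * qpoch (q ^ (-(x : ℤ))) q k *
        qpoch (s * q ^ (i + j + 1)) q k * q ^ k /
      (qpoch (r * q) q k * qpoch (q ^ ((j : ℤ) - (N : ℤ))) q k * qpoch q q k)

/-- The q-hypergeometric-type sum `φ'(j,x,y)` entering the dual q-Hahn part. -/
noncomputable def qphi' (N : ℕ) (q ρ σ : ℂ) (j x y : ℕ) : ℂ :=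
  ∑ k ∈ Finset.range (min j y + 1),
    qpoch (q ^ (-(j : ℤ))) q k * qpoch (q ^ (-(y : ℤ))) q k *
        qpoch (σ * q ^ (x + y + 1)) q k * q ^ k /
      (qpoch (ρ * q) q k * qpoch (q ^ ((x : ℤ) - (N : ℤ))) q k * qpoch q q k)

/-- The q-Hahn / dual q-Hahn Tratnik function `T_{i,j}(x,y)`. -/
noncomputable def qTratnikT (N : ℕ) (q r s ρ σ : ℂ) (i j x y : ℕ) : ℂ :=
  (-1 : ℂ) ^ j * q ^ (((j : ℤ) * ((j : ℤ) - 3 - 2 * (N : ℤ))) / 2) *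
      qbinom q (N - j) i * qbinom q (N - x) j *
      (qpoch (r * q) q i * qpoch (s * q ^ (j + 2)) q (N - j) * qpoch (ρ * q) q j) /
      ((r * q) ^ i * qpoch (s * q ^ (j + 1) / r) q i * qpoch (s * q ^ (i + j + 1)) q i *
        qpoch (s * q ^ (2 * i + j + 2)) q (N - i - j) * σ ^ j *
        qpoch (q ^ (-(N : ℤ)) * ρ / σ) q j) *
    qphi N q r s i j x * qphi' N q ρ σ j x y

/-- The weight function `F(x,y)`. -/
noncomputable def qwF (N : ℕ) (q r s ρ σ : ℂ) (x y : ℕ) : ℂ :=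
  qtrinom q N x y *
    ((-1 : ℂ) ^ N * q ^ ((y : ℤ) * ((x : ℤ) + (y : ℤ) - (N : ℤ))) * qpoch (r * q) q x *
      qpoch (ρ * q) q y * qpoch (ρ * q ^ (-(N : ℤ)) / σ) q (N - x - y)) /
    ((q * r) ^ x * qpoch (q ^ ((N : ℤ) - (x : ℤ) + 1) * s / r) q x *
      qpoch (σ * q ^ (x + y + 1)) q y * qpoch (q ^ (-(y : ℤ) - (N : ℤ) - 1) / σ) q (N - x - y))

/-- The weight function `G(i,j)`. -/
noncomputable def qwG (N : ℕ) (q r s ρ σ : ℂ) (i j : ℕ) : ℂ :=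
  qtrinom q N i j *
    (q ^ ((-(N : ℤ) * ((N : ℤ) + 3)) / 2) * q ^ (j * (j + 2)) * qpoch (r * q) q i *
      qpoch (ρ * q) q j * (qpoch (s * q ^ (j + 2)) q (N - j)) ^ 2) /
    ((r * q) ^ i * (σ * q ^ (N + 2)) ^ j * qpoch (s * q ^ (j + 1) / r) q i *
      qpoch (s * q ^ (i + j + 1)) q i * qpoch (ρ * q ^ (-(N : ℤ)) / σ) q j * s ^ (N - j) *
      qpoch (r * q ^ (-(N : ℤ)) / s) q (N - j) * qpoch (s * q ^ (2 * i + j + 2)) q (N - i - j))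

open Finset Polynomial

lemma qpoch_zero (a q : ℂ) : qpoch a q 0 = 1 := by simp [qpoch]

lemma qpoch_succ (a q : ℂ) (n : ℕ) : qpoch a q (n + 1) = qpoch a q n * (1 - a * q ^ n) := by
  simp [qpoch, prod_range_succ]

lemma qpoch_add (a q : ℂ) (m n : ℕ) :
    qpoch a q (m + n) = qpoch a q m * qpoch (a * q ^ m) q n := by
  simp only [qpoch, prod_range_add]
  congr 1
  exact prod_congr rfl fun l _ => by ring

lemma qpoch_succ' (a q : ℂ) (n : ℕ) : qpoch a q (n + 1) = (1 - a) * qpoch (a * q) q n := by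
  rw [add_comm, qpoch_add]
  simp [qpoch]

lemma qpoch_ne_zero {a q : ℂ} {n : ℕ} (h : ∀ l < n, a * q ^ l ≠ 1) : qpoch a q n ≠ 0 :=
  prod_ne_zero_iff.2 fun l hl => sub_ne_zero.2 (h l (mem_range.1 hl)).symm

lemma qpoch_self_ne_zero {q : ℂ} (hq1 : ∀ m : ℕ, 1 ≤ m → q ^ m ≠ 1) (n : ℕ) :
    qpoch q q n ≠ 0 :=
  qpoch_ne_zero fun l _ => by rw [← pow_succ']; exact hq1 _ (by omega)

/-- Reversal of the order of the factors of a `q`-Pochhammer symbol. -/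
lemma qpoch_reverse {z q w : ℂ} (hq : q ≠ 0) (n : ℕ) (hw : w * (z * q ^ n) = q) :
    z ^ n * q ^ (n.choose 2) * qpoch w q n = (-1) ^ n * qpoch z q n := by
  induction n generalizing w with
  | zero => simp [qpoch_zero]
  | succ n ih =>
    have hw' : w * q * (z * q ^ n) = q := by linear_combination hw
    have h := ih hw'
    have hwz : w * (z * q ^ n) = 1 := by
      apply mul_right_cancel₀ hq
      linear_combination hw
    rw [qpoch_succ' w, qpoch_succ z, Nat.choose_succ_succ' n 1, Nat.choose_one_right, pow_succ z,
      pow_add q, pow_succ (-1 : ℂ)]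
    linear_combination (z * q ^ n - 1) * h -
      z ^ n * q ^ n.choose 2 * qpoch (w * q) q n * hwz

/-- The sign and power of `q` in `(q^{-n};q)_k`. -/
noncomputable def qsign (q : ℂ) (k : ℕ) : ℂ := ∏ l ∈ range k, -(q ^ (l + 1))⁻¹

lemma qsign_succ (q : ℂ) (k : ℕ) : qsign q (k + 1) = qsign q k * -(q ^ (k + 1))⁻¹ :=
  prod_range_succ _ _

lemma qsign_ne_zero {q : ℂ} (hq : q ≠ 0) (k : ℕ) : qsign q k ≠ 0 :=
  prod_ne_zero_iff.2 fun _ _ => neg_ne_zero.2 (inv_ne_zero (pow_ne_zero _ hq))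

lemma qpoch_neg_mul {q : ℂ} (hq : q ≠ 0) (k m : ℕ) :
    qpoch (q ^ (-((k + m : ℕ) : ℤ))) q k * (q ^ (m * k) * qpoch q q m) =
      qsign q k * qpoch q q (k + m) := by
  induction k generalizing m with
  | zero => simp [qpoch_zero, qsign]
  | succ k ih =>
    have h := ih (m + 1)
    have e1 : k + (m + 1) = k + 1 + m := by ring
    have e2 : q ^ (-((k + 1 + m : ℕ) : ℤ)) * q ^ k = (q ^ (m + 1))⁻¹ := by
      rw [zpow_neg, zpow_natCast]
      field_simp
      ring
    have e3 : (q ^ (m + 1))⁻¹ * q ^ (m + 1) = 1 := inv_mul_cancel₀ (pow_ne_zero _ hq)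
    have e4 : (q ^ (k + 1))⁻¹ * q ^ (k + 1) = 1 := inv_mul_cancel₀ (pow_ne_zero _ hq)
    rw [e1, qpoch_succ q q m] at h
    rw [qpoch_succ, e2, qsign_succ, mul_right_comm (qsign q k), ← h]
    generalize (q ^ (m + 1))⁻¹ = u at *
    generalize (q ^ (k + 1))⁻¹ = v at *
    have e5 : q ^ ((m + 1) * k) = q ^ (m * k) * q ^ k := by ring
    have e6 : q ^ (m * (k + 1)) = q ^ (m * k) * q ^ m := by ring
    have e7 : (1 - u) * q ^ m = -v * q ^ k * (1 - q * q ^ m) := by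
      apply mul_right_cancel₀ hq
      linear_combination (-1 : ℂ) * e3 + (1 - q * q ^ m) * e4
    rw [e5, e6]
    linear_combination qpoch (q ^ (-((k + 1 + m : ℕ) : ℤ))) q k * q ^ (m * k) * qpoch q q m * e7

lemma qpoch_neg_eq_zero {q : ℂ} (hq : q ≠ 0) {n k : ℕ} (h : n < k) :
    qpoch (q ^ (-(n : ℤ))) q k = 0 := by
  refine prod_eq_zero (mem_range.2 h) ?_
  rw [zpow_neg, zpow_natCast, inv_mul_cancel₀ (pow_ne_zero _ hq), sub_self]

/-- The `q`-Chu–Vandermonde sum as a convolution. -/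
lemma qVandermonde_convolution {q : ℂ} (hq1 : ∀ m : ℕ, 1 ≤ m → q ^ m ≠ 1) (A B : ℂ) (n : ℕ) :
    ∑ p ∈ antidiagonal n, qpoch A q p.1 / qpoch q q p.1 * (qpoch B q p.2 / qpoch q q p.2) *
      A ^ p.2 = qpoch (A * B) q n / qpoch q q n := by
  have hs : ∀ (C : ℂ) (k : ℕ), qpoch C q (k + 1) / qpoch q q (k + 1) * (1 - q ^ (k + 1)) =
      qpoch C q k / qpoch q q k * (1 - C * q ^ k) := by
    intro C k
    have h1 := qpoch_self_ne_zero hq1 k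
    have h2 := qpoch_self_ne_zero hq1 (k + 1)
    rw [qpoch_succ C, div_mul_eq_mul_div, div_mul_eq_mul_div, div_eq_div_iff h2 h1, qpoch_succ q]
    ring
  induction n with
  | zero => simp [qpoch_zero]
  | succ n ih =>
    have hn : (1 - q ^ (n + 1)) ≠ 0 := sub_ne_zero.2 (hq1 _ (by omega)).symm
    apply mul_right_cancel₀ hn
    rw [hs, ← ih, sum_mul, sum_mul]
    have hsplit : ∀ p ∈ antidiagonal (n + 1),
        qpoch A q p.1 / qpoch q q p.1 * (qpoch B q p.2 / qpoch q q p.2) * A ^ p.2 *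
          (1 - q ^ (n + 1)) =
        qpoch A q p.1 / qpoch q q p.1 * (1 - q ^ p.1) * (qpoch B q p.2 / qpoch q q p.2) * A ^ p.2 +
        q ^ p.1 * (qpoch A q p.1 / qpoch q q p.1) *
          (qpoch B q p.2 / qpoch q q p.2 * (1 - q ^ p.2)) * A ^ p.2 := by
      intro p hp
      rw [← mem_antidiagonal.1 hp, pow_add]
      ring
    rw [sum_congr rfl hsplit, sum_add_distrib, Nat.sum_antidiagonal_succ,
      Nat.sum_antidiagonal_succ']
    simp only [pow_zero, sub_self, mul_zero, zero_mul, zero_add, hs]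
    rw [← sum_add_distrib]
    refine sum_congr rfl fun p hp => ?_
    rw [← mem_antidiagonal.1 hp]
    ring

lemma qVandermonde_aux {q : ℂ} (hq : q ≠ 0) (hq1 : ∀ m : ℕ, 1 ≤ m → q ^ m ≠ 1) (C D : ℂ) (n : ℕ) :
    ∑ p ∈ antidiagonal n, qsign q p.1 * q ^ p.1 * (q ^ (p.1 * p.2))⁻¹ /
      (qpoch q q p.1 * qpoch q q p.2) * qpoch C q p.1 * qpoch (D * q ^ p.1) q p.2 =
      (∏ t ∈ range n, (C - D * q ^ t)) / qpoch q q n := by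
  have hs : ∀ k : ℕ, (1 - q ^ (k + 1)) / qpoch q q (k + 1) = 1 / qpoch q q k := by
    intro k
    have h1 := qpoch_self_ne_zero hq1 k
    have h2 := qpoch_self_ne_zero hq1 (k + 1)
    rw [div_eq_div_iff h2 h1, qpoch_succ q]
    ring
  induction n generalizing D with
  | zero => simp [qpoch_zero, qsign]
  | succ n ih =>
    have hn : (1 - q ^ (n + 1)) ≠ 0 := sub_ne_zero.2 (hq1 _ (by omega)).symm
    apply mul_right_cancel₀ hn
    have hr : (∏ t ∈ range (n + 1), (C - D * q ^ t)) / qpoch q q (n + 1) * (1 - q ^ (n + 1)) =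
        (C - D) * ((∏ t ∈ range n, (C - D * q * q ^ t)) / qpoch q q n) := by
      rw [div_mul_eq_mul_div, mul_div_assoc, hs, prod_range_succ']
      rw [prod_congr rfl fun t _ => show C - D * q ^ (t + 1) = C - D * q * q ^ t by ring]
      simp; ring
    rw [hr, ← ih (D * q), sum_mul, mul_sum]
    have hsplit : ∀ p ∈ antidiagonal (n + 1),
        qsign q p.1 * q ^ p.1 * (q ^ (p.1 * p.2))⁻¹ / (qpoch q q p.1 * qpoch q q p.2) *
          qpoch C q p.1 * qpoch (D * q ^ p.1) q p.2 * (1 - q ^ (n + 1)) =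
        qsign q p.1 * q ^ p.1 * (q ^ (p.1 * p.2))⁻¹ / qpoch q q p.1 *
          ((1 - q ^ p.2) / qpoch q q p.2) * qpoch C q p.1 * qpoch (D * q ^ p.1) q p.2 +
        qsign q p.1 * q ^ p.1 * (q ^ (p.1 * p.2))⁻¹ * ((1 - q ^ p.1) / qpoch q q p.1) * q ^ p.2 /
          qpoch q q p.2 * qpoch C q p.1 * qpoch (D * q ^ p.1) q p.2 := by
      intro p hp
      rw [← mem_antidiagonal.1 hp, pow_add]
      ring
    rw [sum_congr rfl hsplit, sum_add_distrib, Nat.sum_antidiagonal_succ',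
      Nat.sum_antidiagonal_succ]
    simp only [pow_zero, sub_self, zero_div, mul_zero, zero_mul, zero_add, hs]
    rw [← sum_add_distrib]
    refine sum_congr rfl fun p hp => ?_
    rw [qpoch_succ' (D * q ^ p.1), qpoch_succ C, qsign_succ]
    rw [show D * q ^ p.1 * q = D * q * q ^ p.1 by ring,
      show D * q ^ (p.1 + 1) = D * q * q ^ p.1 by ring]
    have h1 := qpoch_self_ne_zero hq1 p.1
    have h2 := qpoch_self_ne_zero hq1 p.2
    field_simp
    ring

/-- The `q`-Chu–Vandermonde sum for a terminating `₂φ₁` at argument `q`. -/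
lemma qVandermonde {q : ℂ} (hq : q ≠ 0) (hq1 : ∀ m : ℕ, 1 ≤ m → q ^ m ≠ 1) (C D : ℂ) (n : ℕ)
    (hD : qpoch D q n ≠ 0) :
    ∑ k ∈ range (n + 1), qpoch (q ^ (-(n : ℤ))) q k * qpoch C q k * q ^ k /
      (qpoch D q k * qpoch q q k) = (∏ t ∈ range n, (C - D * q ^ t)) / qpoch D q n := by
  have h := qVandermonde_aux hq hq1 C D n
  rw [eq_div_iff (qpoch_self_ne_zero hq1 n)] at h
  rw [← h, ← Nat.sum_antidiagonal_eq_sum_range_succ (fun k _ =>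
    qpoch (q ^ (-(n : ℤ))) q k * qpoch C q k * q ^ k / (qpoch D q k * qpoch q q k)) n, sum_mul,
    sum_div]
  refine sum_congr rfl fun p hp => ?_
  obtain ⟨k, m⟩ := p
  obtain rfl : k + m = n := mem_antidiagonal.1 hp
  have h1 := qpoch_self_ne_zero hq1 k
  have h2 := qpoch_self_ne_zero hq1 m
  have h3 := qpoch_neg_mul hq k m
  rw [qpoch_add D] at hD ⊢
  have h4 := left_ne_zero_of_mul hD
  have h5 := right_ne_zero_of_mul hD
  have h6 : q ^ (k * m) = q ^ (m * k) := by rw [mul_comm]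
  simp only [h6]
  generalize qpoch (D * q ^ k) q m = u at h5 ⊢
  field_simp
  linear_combination qpoch C q k * h3

lemma linearMap_eq_zero_of_triangular (L : ℂ[X] →ₗ[ℂ] ℂ) (e : ℕ → ℂ[X])
    (he0 : ∀ l k, l < k → (e l).coeff k = 0) (he : ∀ l, (e l).coeff l ≠ 0) (d : ℕ)
    (hL : ∀ l < d, L (e l) = 0) (P : ℂ[X]) (hP : ∀ k, d ≤ k → P.coeff k = 0) : L P = 0 := by
  induction d generalizing P with
  | zero =>
    have : P = 0 := by ext k; simpa using hP k (Nat.zero_le k)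
    simp [this]
  | succ d ih =>
    have h := ih (fun l hl => hL l (by omega)) (P - (P.coeff d / (e d).coeff d) • e d) (by
      intro k hk
      rcases hk.eq_or_lt with rfl | hk
      · simp [he]
      · simp [hP k hk, he0 d k hk])
    simpa [hL d (by omega)] using h

lemma linearMap_mul_coeff_of_triangular (L : ℂ[X] →ₗ[ℂ] ℂ) (e : ℕ → ℂ[X])
    (he0 : ∀ l k, l < k → (e l).coeff k = 0) (he : ∀ l, (e l).coeff l ≠ 0) (n : ℕ)
    (hL : ∀ l < n, L (e l) = 0) (P : ℂ[X]) (hP : ∀ k, n < k → P.coeff k = 0) :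
    L P * (e n).coeff n = P.coeff n * L (e n) := by
  have h := linearMap_eq_zero_of_triangular L e he0 he n hL
    ((e n).coeff n • P - P.coeff n • e n) (by
      intro k hk
      rcases hk.eq_or_lt with rfl | hk
      · simp; ring
      · simp [hP k hk, he0 n k hk])
  simp only [map_sub, map_smul, smul_eq_mul] at h
  linear_combination h

/-- The polynomial `(uX;q)_l`. -/
noncomputable def qpochPoly (u q : ℂ) (l : ℕ) : ℂ[X] :=
  ∏ t ∈ range l, (1 - C (u * q ^ t) * X)

lemma qpochPoly_eval (u q z : ℂ) (l : ℕ) : (qpochPoly u q l).eval z = qpoch (u * z) q l := by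
  simp only [qpochPoly, qpoch, eval_prod]
  refine prod_congr rfl fun t _ => ?_
  simp; ring

lemma qpochPoly_coeff_succ (u q : ℂ) (l k : ℕ) : (qpochPoly u q (l + 1)).coeff (k + 1) =
    (qpochPoly u q l).coeff (k + 1) - u * q ^ l * (qpochPoly u q l).coeff k := by
  rw [qpochPoly, prod_range_succ, ← qpochPoly, mul_sub, mul_one, coeff_sub, mul_left_comm,
    coeff_C_mul, coeff_mul_X]

lemma qpochPoly_coeff_eq_zero (u q : ℂ) {l k : ℕ} (h : l < k) : (qpochPoly u q l).coeff k = 0 := by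
  induction l generalizing k with
  | zero => simp [qpochPoly, coeff_one, h.ne']
  | succ l ih =>
    obtain ⟨k, rfl⟩ := Nat.exists_eq_add_of_lt h
    rw [qpochPoly_coeff_succ, ih (by omega), ih (by omega)]
    ring

lemma qpochPoly_coeff_self (u q : ℂ) (l : ℕ) :
    (qpochPoly u q l).coeff l = ∏ t ∈ range l, -(u * q ^ t) := by
  induction l with
  | zero => simp [qpochPoly]
  | succ l ih =>
    rw [qpochPoly_coeff_succ, qpochPoly_coeff_eq_zero u q (by omega), ih, prod_range_succ]
    ring

/-- The coefficients of the `q`-Hahn polynomial in the basis `(q^{-x};q)_k`. -/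
noncomputable def qhahnCoeff (q a c : ℂ) (M n k : ℕ) : ℂ :=
  qpoch (q ^ (-(n : ℤ))) q k * qpoch (c * q ^ (n + 1)) q k * q ^ k /
    (qpoch (a * q) q k * qpoch (q ^ (-(M : ℤ))) q k * qpoch q q k)

/-- The `q`-Hahn polynomial of degree `n` in `q^{-x}`, with `c` the product of its two
parameters. -/
noncomputable def qhahn (q a c : ℂ) (M n x : ℕ) : ℂ :=
  ∑ k ∈ range (M + 1), qhahnCoeff q a c M n k * qpoch (q ^ (-(x : ℤ))) q k

/-- The weight for which the `q`-Hahn polynomials are orthogonal. -/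
noncomputable def qhahnWeight (q a b : ℂ) (M x : ℕ) : ℂ :=
  qpoch (a * q) q x * qpoch (b * q) q (M - x) /
    (qpoch q q x * qpoch q q (M - x) * (a * q) ^ x)

/-- The squared norm of the `q`-Hahn polynomial of degree `n`. -/
noncomputable def qhahnNorm (q a b : ℂ) (M n : ℕ) : ℂ :=
  qpoch q q n * qpoch q q (M - n) * qpoch (a * b * q ^ (n + 1)) q n *
    qpoch (a * b * q ^ (2 * n + 2)) q (M - n) * qpoch (b * q) q n /
    (qpoch q q M ^ 2 * qpoch (a * q) q n * (a * q) ^ (M - n))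

lemma qhahnCoeff_eq_zero {q : ℂ} (hq : q ≠ 0) (a c : ℂ) (M : ℕ) {n k : ℕ} (h : n < k) :
    qhahnCoeff q a c M n k = 0 := by
  rw [qhahnCoeff, qpoch_neg_eq_zero hq h, zero_mul, zero_mul, zero_div]

lemma qhahnWeight_moment {q a : ℂ} (b : ℂ) (hq : q ≠ 0) (hq1 : ∀ m : ℕ, 1 ≤ m → q ^ m ≠ 1)
    (ha : a ≠ 0) (k n l : ℕ) :
    ∑ x ∈ range (k + n + 1), qhahnWeight q a b (k + n) x * qpoch (q ^ (-(x : ℤ))) q k *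
      qpoch (b * q ^ (k + n - x + 1)) q l =
    qpoch (b * q) q l * qsign q k * qpoch (a * q) q k * qpoch (a * b * q ^ (k + l + 2)) q n /
      ((a * q) ^ k * (a * q ^ (k + 1)) ^ n * qpoch q q n) := by
  have hV := qVandermonde_convolution hq1 (a * q ^ (k + 1)) (b * q ^ (l + 1)) n
  rw [Nat.sum_antidiagonal_eq_sum_range_succ_mk] at hV
  rw [show a * q ^ (k + 1) * (b * q ^ (l + 1)) = a * b * q ^ (k + l + 2) by ring] at hV
  have hr : qpoch (b * q) q l * qsign q k * qpoch (a * q) q k *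
      qpoch (a * b * q ^ (k + l + 2)) q n / ((a * q) ^ k * (a * q ^ (k + 1)) ^ n * qpoch q q n) =
      qpoch (b * q) q l * qsign q k * qpoch (a * q) q k / ((a * q) ^ k * (a * q ^ (k + 1)) ^ n) *
        (qpoch (a * b * q ^ (k + l + 2)) q n / qpoch q q n) := by ring
  rw [hr, ← hV, mul_sum, add_assoc, sum_range_add, sum_eq_zero, zero_add]
  · refine sum_congr rfl fun x hx => ?_
    obtain ⟨y, rfl⟩ := Nat.exists_eq_add_of_le (Nat.lt_succ_iff.1 (mem_range.1 hx))
    have e1 : k + (x + y) - (k + x) = y := by omega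
    have e2 : x + y - x = y := by omega
    have h1 := qpoch_self_ne_zero hq1 x
    have h2 := qpoch_self_ne_zero hq1 y
    have h3 := qpoch_self_ne_zero hq1 (k + x)
    have h4 := qpoch_neg_mul hq k x
    have h5 : qpoch (b * q) q y * qpoch (b * q ^ (y + 1)) q l =
        qpoch (b * q) q l * qpoch (b * q ^ (l + 1)) q y := by
      have := qpoch_add (b * q) q y l
      rw [add_comm, qpoch_add] at this
      rw [show b * q ^ (y + 1) = b * q * q ^ y by ring,
        show b * q ^ (l + 1) = b * q * q ^ l by ring, ← this]
    have h6 : qpoch (a * q) q (k + x) = qpoch (a * q) q k * qpoch (a * q ^ (k + 1)) q x := by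
      rw [qpoch_add, show a * q ^ (k + 1) = a * q * q ^ k by ring]
    have h7 : qpoch (q ^ (-((k + x : ℕ) : ℤ))) q k =
        qsign q k * qpoch q q (k + x) / (q ^ (x * k) * qpoch q q x) := by
      rw [eq_div_iff (mul_ne_zero (pow_ne_zero _ hq) h1), h4]
    simp only [qhahnWeight, e1, e2]
    have hl : qpoch (a * q) q (k + x) * qpoch (b * q) q y /
        (qpoch q q (k + x) * qpoch q q y * (a * q) ^ (k + x)) *
        qpoch (q ^ (-((k + x : ℕ) : ℤ))) q k * qpoch (b * q ^ (y + 1)) q l =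
      qpoch (a * q) q (k + x) * (qpoch (b * q) q y * qpoch (b * q ^ (y + 1)) q l) /
        (qpoch q q (k + x) * qpoch q q y * (a * q) ^ (k + x)) *
        qpoch (q ^ (-((k + x : ℕ) : ℤ))) q k := by ring
    rw [hl, h5, h6, h7]
    field_simp
    ring
  · intro x hx
    rw [qpoch_neg_eq_zero hq (mem_range.1 hx)]
    ring

lemma sum_qhahnWeight_mul_qhahn_mul_qpoch {q a b : ℂ} (hq : q ≠ 0)
    (hq1 : ∀ m : ℕ, 1 ≤ m → q ^ m ≠ 1) (ha : a ≠ 0) (M n l : ℕ) (hnM : n ≤ M) (hln : l ≤ n)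
    (haq : ∀ m : ℕ, 1 ≤ m → m ≤ M → a * q ^ m ≠ 1)
    (hc : ∀ m : ℕ, 2 ≤ m → m ≤ 2 * M + 1 → a * b * q ^ m ≠ 1) :
    ∑ x ∈ range (M + 1), qhahnWeight q a b M x * qhahn q a (a * b) M n x *
      qpoch (b * q ^ (M - x + 1)) q l =
    qpoch (b * q) q l * qpoch (a * b * q ^ (l + 2)) q M / ((a * q) ^ M * qpoch q q M) *
      ((∏ t ∈ range n, (a * b * q ^ (n + 1) - a * b * q ^ (l + 2) * q ^ t)) /
        qpoch (a * b * q ^ (l + 2)) q n) := by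
  have hD : ∀ k ≤ n, qpoch (a * b * q ^ (l + 2)) q k ≠ 0 := fun k hk => qpoch_ne_zero fun t ht => by
    rw [mul_assoc, ← pow_add]
    exact hc _ (by omega) (by omega)
  rw [← qVandermonde hq hq1 _ _ _ (hD n le_rfl), mul_sum]
  have hswap : ∀ x ∈ range (M + 1), qhahnWeight q a b M x * qhahn q a (a * b) M n x *
      qpoch (b * q ^ (M - x + 1)) q l = ∑ k ∈ range (M + 1), qhahnCoeff q a (a * b) M n k *
        (qhahnWeight q a b M x * qpoch (q ^ (-(x : ℤ))) q k *
          qpoch (b * q ^ (M - x + 1)) q l) := by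
    intro x _
    rw [qhahn, mul_sum, sum_mul]
    exact sum_congr rfl fun k _ => by ring
  rw [sum_congr rfl hswap, sum_comm]
  symm
  apply sum_subset_zero_on_sdiff (range_subset_range.2 (by omega))
  · intro k hk
    rw [← mul_sum, qhahnCoeff_eq_zero hq _ _ _ (by simp at hk; omega), zero_mul]
  intro k hk
  have hkn : k ≤ n := Nat.lt_succ_iff.1 (mem_range.1 hk)
  obtain ⟨m, rfl⟩ := Nat.exists_eq_add_of_le (hkn.trans hnM)
  rw [← mul_sum, qhahnWeight_moment b hq hq1 ha]
  have h1 := qpoch_self_ne_zero hq1 k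
  have h2 := qpoch_self_ne_zero hq1 m
  have h3 := qpoch_self_ne_zero hq1 (k + m)
  have h4 := qsign_ne_zero hq k
  have h5 := hD k hkn
  have h6 : qpoch (a * q) q k ≠ 0 := qpoch_ne_zero fun t ht => by
    rw [mul_assoc, ← pow_succ']
    exact haq _ (by omega) (by omega)
  have h7 : qpoch (q ^ (-((k + m : ℕ) : ℤ))) q k =
      qsign q k * qpoch q q (k + m) / (q ^ (m * k) * qpoch q q m) := by
    rw [eq_div_iff (mul_ne_zero (pow_ne_zero _ hq) h2), qpoch_neg_mul hq]
  have h8 : qpoch (a * b * q ^ (l + 2)) q (k + m) = qpoch (a * b * q ^ (l + 2)) q k *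
      qpoch (a * b * q ^ (k + l + 2)) q m := by
    rw [qpoch_add]
    congr 2
    ring
  rw [qhahnCoeff, h7, h8]
  generalize qpoch (a * b * q ^ (l + 2)) q k = u at h5 ⊢
  generalize qpoch (a * q) q k = v at h6 ⊢
  field_simp
  ring

/-- The `q`-Hahn polynomial as a polynomial in the variable `q^{-x}`. -/
noncomputable def qhahnPoly (q a c : ℂ) (M n : ℕ) : ℂ[X] :=
  ∑ k ∈ range (M + 1), qhahnCoeff q a c M n k • qpochPoly 1 q k

lemma qhahnPoly_eval (q a c : ℂ) (M n x : ℕ) :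
    (qhahnPoly q a c M n).eval (q ^ (-(x : ℤ))) = qhahn q a c M n x := by
  simp [qhahnPoly, qhahn, eval_finsetSum, qpochPoly_eval]

lemma qhahnPoly_coeff {q : ℂ} (hq : q ≠ 0) (a c : ℂ) {M m n : ℕ} (hmn : m ≤ n) (hn : n ≤ M) :
    (qhahnPoly q a c M m).coeff n = qhahnCoeff q a c M m n * ∏ t ∈ range n, -(q ^ t) := by
  rw [qhahnPoly, finsetSum_coeff, sum_eq_single n]
  · simp [qpochPoly_coeff_self]
  · intro k _ hk
    rcases lt_or_gt_of_ne hk with hk | hk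
    · simp [qpochPoly_coeff_eq_zero 1 q hk]
    · simp [qhahnCoeff_eq_zero hq a c M (hmn.trans_lt hk)]
  · intro h
    exact absurd (mem_range.2 (by omega)) h

lemma qhahnPoly_coeff_eq_zero {q : ℂ} (hq : q ≠ 0) (a c : ℂ) {M m k : ℕ} (hmk : m < k) :
    (qhahnPoly q a c M m).coeff k = 0 := by
  rw [qhahnPoly, finsetSum_coeff]
  refine sum_eq_zero fun l _ => ?_
  rcases lt_or_ge l k with hl | hl
  · simp [qpochPoly_coeff_eq_zero 1 q hl]
  · simp [qhahnCoeff_eq_zero hq a c M (hmk.trans_le hl)]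

lemma qhahnCoeff_mul_eq_norm {q a b : ℂ} (hq : q ≠ 0) (hq1 : ∀ m : ℕ, 1 ≤ m → q ^ m ≠ 1)
    (ha : a ≠ 0) (M n : ℕ) (hn : n ≤ M)
    (haq : ∀ m : ℕ, 1 ≤ m → m ≤ M → a * q ^ m ≠ 1)
    (hc : ∀ m : ℕ, 2 ≤ m → m ≤ 2 * M + 1 → a * b * q ^ m ≠ 1) :
    qhahnCoeff q a (a * b) M n n *
      (qpoch (b * q) q n * qpoch (a * b * q ^ (n + 2)) q M / ((a * q) ^ M * qpoch q q M) *
      (((a * b * q ^ (n + 1)) ^ n * qpoch q q n) / qpoch (a * b * q ^ (n + 2)) q n)) =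
    qhahnNorm q a b M n * (b * q ^ (M + 1)) ^ n := by
  obtain ⟨m, rfl⟩ := Nat.exists_eq_add_of_le hn
  have h1 := qpoch_self_ne_zero hq1 n
  have h2 := qpoch_self_ne_zero hq1 m
  have h3 := qpoch_self_ne_zero hq1 (n + m)
  have h4 := qsign_ne_zero hq n
  have h5 : qpoch (a * b * q ^ (n + 2)) q n ≠ 0 := qpoch_ne_zero fun t ht => by
    rw [mul_assoc, ← pow_add]
    exact hc _ (by omega) (by omega)
  have h6 : qpoch (a * q) q n ≠ 0 := qpoch_ne_zero fun t ht => by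
    rw [mul_assoc, ← pow_succ']
    exact haq _ (by omega) (by omega)
  have h7 : qpoch (q ^ (-((n + m : ℕ) : ℤ))) q n =
      qsign q n * qpoch q q (n + m) / (q ^ (m * n) * qpoch q q m) := by
    rw [eq_div_iff (mul_ne_zero (pow_ne_zero _ hq) h2), qpoch_neg_mul hq]
  have h8 : qpoch (a * b * q ^ (n + 2)) q (n + m) = qpoch (a * b * q ^ (n + 2)) q n *
      qpoch (a * b * q ^ (2 * n + 2)) q m := by
    rw [qpoch_add]
    congr 2
    ring
  have h9 : qpoch (q ^ (-(n : ℤ))) q n = qsign q n * qpoch q q n := by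
    simpa [qpoch_zero] using qpoch_neg_mul hq n 0
  rw [qhahnCoeff, qhahnNorm, h7, h8, h9, Nat.add_sub_cancel_left]
  generalize qpoch (a * b * q ^ (n + 2)) q n = u at h5 ⊢
  generalize qpoch (a * q) q n = v at h6 ⊢
  field_simp
  ring

/-- Orthogonality of the `q`-Hahn polynomials. -/
theorem qhahn_orthogonality {q a b : ℂ} (hq : q ≠ 0) (hq1 : ∀ m : ℕ, 1 ≤ m → q ^ m ≠ 1)
    (ha : a ≠ 0) (hb : b ≠ 0) {M : ℕ} (haq : ∀ m : ℕ, 1 ≤ m → m ≤ M → a * q ^ m ≠ 1)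
    (hc : ∀ m : ℕ, 2 ≤ m → m ≤ 2 * M + 1 → a * b * q ^ m ≠ 1) {m n : ℕ} (hm : m ≤ M)
    (hn : n ≤ M) :
    ∑ x ∈ range (M + 1), qhahnWeight q a b M x * qhahn q a (a * b) M m x *
      qhahn q a (a * b) M n x = if m = n then qhahnNorm q a b M n else 0 := by
  wlog hmn : m ≤ n generalizing m n
  · have h := this hn hm (by omega)
    rw [if_neg (by omega)] at h ⊢
    rw [← h]
    exact sum_congr rfl fun x _ => by ring
  let L : ℂ[X] →ₗ[ℂ] ℂ := ∑ x ∈ range (M + 1),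
    (qhahnWeight q a b M x * qhahn q a (a * b) M n x) • leval (q ^ (-(x : ℤ)))
  have hL : ∀ P : ℂ[X], L P = ∑ x ∈ range (M + 1),
      qhahnWeight q a b M x * qhahn q a (a * b) M n x * P.eval (q ^ (-(x : ℤ))) := by
    intro P
    simp [L, LinearMap.sum_apply]
  have hLe : ∀ l ≤ n, L (qpochPoly (b * q ^ (M + 1)) q l) =
      qpoch (b * q) q l * qpoch (a * b * q ^ (l + 2)) q M / ((a * q) ^ M * qpoch q q M) *
        ((∏ t ∈ range n, (a * b * q ^ (n + 1) - a * b * q ^ (l + 2) * q ^ t)) /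
          qpoch (a * b * q ^ (l + 2)) q n) := by
    intro l hl
    rw [hL, ← sum_qhahnWeight_mul_qhahn_mul_qpoch hq hq1 ha M n l hn hl haq hc]
    refine sum_congr rfl fun x hx => ?_
    rw [qpochPoly_eval]
    congr 2
    obtain ⟨y, rfl⟩ := Nat.exists_eq_add_of_le (Nat.lt_succ_iff.1 (mem_range.1 hx))
    rw [Nat.add_sub_cancel_left, zpow_neg, zpow_natCast]
    field_simp
    ring
  have hLe0 : ∀ l < n, L (qpochPoly (b * q ^ (M + 1)) q l) = 0 := by
    intro l hl
    rw [hLe l hl.le, prod_eq_zero (mem_range.2 (show n - 1 - l < n by omega)), zero_div, mul_zero]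
    rw [mul_assoc _ (q ^ _), ← pow_add, sub_eq_zero]
    congr 2
    omega
  have hLen : ∏ t ∈ range n, (a * b * q ^ (n + 1) - a * b * q ^ (n + 2) * q ^ t) =
      (a * b * q ^ (n + 1)) ^ n * qpoch q q n := by
    rw [qpoch, ← card_range n, ← prod_const, card_range, ← prod_mul_distrib]
    exact prod_congr rfl fun t _ => by ring
  have hlead : (∏ t ∈ range n, -(b * q ^ (M + 1) * q ^ t)) =
      (b * q ^ (M + 1)) ^ n * ∏ t ∈ range n, -(q ^ t) := by
    rw [← card_range n, ← prod_const, card_range, ← prod_mul_distrib]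
    exact prod_congr rfl fun t _ => by ring
  have hbq : b * q ^ (M + 1) ≠ 0 := mul_ne_zero hb (pow_ne_zero _ hq)
  have hprod : (∏ t ∈ range n, -(q ^ t)) ≠ 0 :=
    prod_ne_zero_iff.2 fun t _ => neg_ne_zero.2 (pow_ne_zero _ hq)
  have key := linearMap_mul_coeff_of_triangular L (qpochPoly (b * q ^ (M + 1)) q)
    (fun l k h => qpochPoly_coeff_eq_zero _ _ h)
    (fun l => by
      rw [qpochPoly_coeff_self]
      exact prod_ne_zero_iff.2 fun t _ => neg_ne_zero.2 (mul_ne_zero hbq (pow_ne_zero _ hq)))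
    n hLe0 (qhahnPoly q a (a * b) M m)
    (fun k hk => qhahnPoly_coeff_eq_zero hq _ _ (hmn.trans_lt hk))
  rw [qpochPoly_coeff_self, hlead, qhahnPoly_coeff hq _ _ hmn hn, hLe n le_rfl, hLen, hL] at key
  simp only [qhahnPoly_eval] at key
  have hsum : ∑ x ∈ range (M + 1), qhahnWeight q a b M x * qhahn q a (a * b) M m x *
      qhahn q a (a * b) M n x = ∑ x ∈ range (M + 1),
      qhahnWeight q a b M x * qhahn q a (a * b) M n x * qhahn q a (a * b) M m x :=
    sum_congr rfl fun x _ => by ring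
  rw [hsum]
  apply mul_right_cancel₀ (mul_ne_zero (pow_ne_zero n hbq) hprod)
  rw [key]
  split_ifs with h
  · subst h
    linear_combination (∏ t ∈ range m, -(q ^ t)) *
      qhahnCoeff_mul_eq_norm hq hq1 ha M m hn haq hc
  · rw [qhahnCoeff_eq_zero hq _ _ _ (lt_of_le_of_ne hmn h)]
    ring

/-- Dual orthogonality of the `q`-Hahn polynomials. -/
theorem qhahn_dual_orthogonality {q a b : ℂ} (hq : q ≠ 0) (hq1 : ∀ m : ℕ, 1 ≤ m → q ^ m ≠ 1)
    (ha : a ≠ 0) (hb : b ≠ 0) {M : ℕ} (haq : ∀ m : ℕ, 1 ≤ m → m ≤ M → a * q ^ m ≠ 1)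
    (hbq : ∀ m : ℕ, 1 ≤ m → m ≤ M → b * q ^ m ≠ 1)
    (hc : ∀ m : ℕ, 1 ≤ m → m ≤ 2 * M + 1 → a * b * q ^ m ≠ 1) {x x' : ℕ} (hx : x ≤ M)
    (hx' : x' ≤ M) :
    ∑ n ∈ range (M + 1), (qhahnNorm q a b M n)⁻¹ * qhahn q a (a * b) M n x *
      qhahn q a (a * b) M n x' = if x = x' then (qhahnWeight q a b M x)⁻¹ else 0 := by
  have hane : ∀ k ≤ M, qpoch (a * q) q k ≠ 0 := fun k hk => qpoch_ne_zero fun t ht => by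
    rw [mul_assoc, ← pow_succ']
    exact haq _ (by omega) (by omega)
  have hbne : ∀ k ≤ M, qpoch (b * q) q k ≠ 0 := fun k hk => qpoch_ne_zero fun t ht => by
    rw [mul_assoc, ← pow_succ']
    exact hbq _ (by omega) (by omega)
  have hqne := qpoch_self_ne_zero hq1
  have haq0 : a * q ≠ 0 := mul_ne_zero ha hq
  have hW : ∀ y ≤ M, qhahnWeight q a b M y ≠ 0 := fun y hy =>
    div_ne_zero (mul_ne_zero (hane y hy) (hbne _ (by omega)))
      (mul_ne_zero (mul_ne_zero (hqne _) (hqne _)) (pow_ne_zero _ haq0))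
  have hH : ∀ n ≤ M, qhahnNorm q a b M n ≠ 0 := by
    intro n hn
    refine div_ne_zero (mul_ne_zero (mul_ne_zero (mul_ne_zero
      (mul_ne_zero (hqne _) (hqne _)) ?_) ?_) (hbne n hn)) (mul_ne_zero (mul_ne_zero (pow_ne_zero _ (hqne _)) (hane n hn))
        (pow_ne_zero _ haq0))
    all_goals
      refine qpoch_ne_zero fun t ht => ?_
      rw [mul_assoc _ (q ^ _), ← pow_add]
      exact hc _ (by omega) (by omega)
  let A : Matrix (Fin (M + 1)) (Fin (M + 1)) ℂ := fun y n => qhahn q a (a * b) M n y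
  let B : Matrix (Fin (M + 1)) (Fin (M + 1)) ℂ := fun n y =>
    (qhahnNorm q a b M n)⁻¹ * qhahn q a (a * b) M n y * qhahnWeight q a b M y
  have hBA : B * A = 1 := by
    ext m n
    have h := qhahn_orthogonality hq hq1 ha hb haq (fun k hk => hc k (by omega))
      (Nat.lt_succ_iff.1 m.2) (Nat.lt_succ_iff.1 n.2)
    rw [Matrix.mul_apply, Fin.sum_univ_eq_sum_range (fun y =>
      (qhahnNorm q a b M m)⁻¹ * qhahn q a (a * b) M m y * qhahnWeight q a b M y *
        qhahn q a (a * b) M n y), Matrix.one_apply]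
    have h' : ∑ y ∈ range (M + 1), (qhahnNorm q a b M m)⁻¹ * qhahn q a (a * b) M m y *
        qhahnWeight q a b M y * qhahn q a (a * b) M n y = (qhahnNorm q a b M m)⁻¹ *
        ∑ y ∈ range (M + 1), qhahnWeight q a b M y * qhahn q a (a * b) M m y *
          qhahn q a (a * b) M n y := by
      rw [mul_sum]
      exact sum_congr rfl fun y _ => by ring
    rw [h', h]
    by_cases hmn : m = n
    · subst hmn
      simp [inv_mul_cancel₀ (hH m (Nat.lt_succ_iff.1 m.2))]
    · simp [hmn, Fin.val_inj]
  have hAB1 : A * B = 1 := mul_eq_one_comm.1 hBA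
  have hAB := congrFun (congrFun hAB1 ⟨x, by omega⟩) ⟨x', by omega⟩
  rw [Matrix.mul_apply, Fin.sum_univ_eq_sum_range (fun n => qhahn q a (a * b) M n x *
    ((qhahnNorm q a b M n)⁻¹ * qhahn q a (a * b) M n x' * qhahnWeight q a b M x')),
    Matrix.one_apply] at hAB
  apply mul_right_cancel₀ (hW x' hx')
  rw [sum_mul, sum_congr rfl fun n _ => show (qhahnNorm q a b M n)⁻¹ * qhahn q a (a * b) M n x *
    qhahn q a (a * b) M n x' * qhahnWeight q a b M x' = qhahn q a (a * b) M n x *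
    ((qhahnNorm q a b M n)⁻¹ * qhahn q a (a * b) M n x' * qhahnWeight q a b M x') by ring, hAB]
  by_cases h : x = x'
  · subst h
    simp [inv_mul_cancel₀ (hW x hx)]
  · simp [h]

lemma qphi_eq_qhahn {q : ℂ} (hq : q ≠ 0) (r s : ℂ) {N i j : ℕ} (x : ℕ) (hj : i + j ≤ N) :
    qphi N q r s i j x = qhahn q r (s * q ^ j) (N - j) i x := by
  refine sum_subset_zero_on_sdiff (range_subset_range.2 (by omega)) (fun k hk => ?_)
    fun k _ => ?_
  · simp only [mem_sdiff, mem_range, not_lt] at hk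
    rcases lt_or_ge i k with h | h
    · rw [qhahnCoeff_eq_zero hq _ _ _ h, zero_mul]
    · rw [qpoch_neg_eq_zero hq (by omega : x < k), mul_zero]
  · rw [qhahnCoeff, show (j : ℤ) - N = -((N - j : ℕ) : ℤ) by omega,
      show s * q ^ (i + j + 1) = s * q ^ j * q ^ (i + 1) by ring]
    ring

lemma qphi'_eq_qhahn {q : ℂ} (hq : q ≠ 0) (ρ σ : ℂ) {N x y : ℕ} (j : ℕ) (hx : x + y ≤ N) :
    qphi' N q ρ σ j x y = qhahn q ρ (σ * q ^ x) (N - x) y j := by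
  refine sum_subset_zero_on_sdiff (range_subset_range.2 (by omega)) (fun k hk => ?_)
    fun k _ => ?_
  · simp only [mem_sdiff, mem_range, not_lt] at hk
    rcases lt_or_ge y k with h | h
    · rw [qhahnCoeff_eq_zero hq _ _ _ h, zero_mul]
    · rw [qpoch_neg_eq_zero hq (by omega : j < k), mul_zero]
  · rw [qhahnCoeff, show (x : ℤ) - N = -((N - x : ℕ) : ℤ) by omega,
      show σ * q ^ (x + y + 1) = σ * q ^ x * q ^ (y + 1) by ring]
    ring

lemma qpoch_mul_pow_ne_zero {a q : ℂ} {m n : ℕ} (h : ∀ k, m ≤ k → k < m + n → a * q ^ k ≠ 1) :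
    qpoch (a * q ^ m) q n ≠ 0 :=
  qpoch_ne_zero fun l hl => by
    rw [mul_assoc, ← pow_add]
    exact h _ (by omega) (by omega)

/-- The part of the weight `F` that does not depend on `y`. -/
noncomputable def qwFx (N : ℕ) (q r s ρ σ : ℂ) (x : ℕ) : ℂ :=
  (-1) ^ N * qpoch q q N * qpoch (r * q) q x * qpoch (σ * q ^ (x + 1) / ρ) q (N - x) /
    (qpoch q q x * qpoch q q (N - x) ^ 2 * (q * r) ^ x * qpoch (q ^ (N - x + 1) * s / r) q x)

lemma qwF_eq {q r ρ σ : ℂ} (s : ℂ) {N x y : ℕ} (hxy : x + y ≤ N) (hq0 : q ≠ 0) (hr0 : r ≠ 0)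
    (hρ0 : ρ ≠ 0) (hσ0 : σ ≠ 0) (hq1 : ∀ m : ℕ, 1 ≤ m → q ^ m ≠ 1)
    (hρ : ∀ m : ℕ, 1 ≤ m → m ≤ N + 1 → ρ * q ^ m ≠ 1)
    (hσ : ∀ m : ℕ, 1 ≤ m → m ≤ 2 * N + 2 → σ * q ^ m ≠ 1)
    (hsr : ∀ m : ℕ, 1 ≤ m → m ≤ 2 * N → s * q ^ m ≠ r)
    (hσρ : ∀ m : ℕ, 1 ≤ m → m ≤ 2 * N → σ * q ^ m ≠ ρ) :
    qwF N q r s ρ σ x y =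
      qwFx N q r s ρ σ x * (qhahnNorm q ρ (σ * q ^ x / ρ) (N - x) y)⁻¹ := by
  obtain ⟨n, rfl⟩ := Nat.exists_eq_add_of_le hxy
  have R1 := qpoch_reverse (z := σ * q ^ (x + 2 * y + 2))
    (w := q ^ (-(y : ℤ) - ((x + y + n : ℕ) : ℤ) - 1) / σ) hq0 n (by
      rw [show -(y : ℤ) - ((x + y + n : ℕ) : ℤ) - 1 = -((x + 2 * y + n + 1 : ℕ) : ℤ) by
        push_cast; ring, zpow_neg, zpow_natCast]
      field_simp
      ring)
  have R2 := qpoch_reverse (z := σ * q ^ (x + y + 1) / ρ)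
    (w := ρ * q ^ (-((x + y + n : ℕ) : ℤ)) / σ) hq0 n (by
      rw [zpow_neg, zpow_natCast]
      field_simp
      ring)
  have hz1 : (σ * q ^ (x + 2 * y + 2)) ^ n * q ^ n.choose 2 ≠ 0 := by simp [hσ0, hq0]
  have hz2 : (σ * q ^ (x + y + 1) / ρ) ^ n * q ^ n.choose 2 ≠ 0 := by simp [hσ0, hq0, hρ0]
  have e1 : x + y + n - x = y + n := by omega
  have e2 : x + y + n - x - y = n := by omega
  have e4 : q ^ ((y : ℤ) * ((x : ℤ) + (y : ℤ) - ((x + y + n : ℕ) : ℤ))) = (q ^ (y * n))⁻¹ := by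
    rw [← zpow_natCast, ← zpow_neg]
    congr 1
    push_cast
    ring
  have e5 : ((x + y + n : ℕ) : ℤ) - x + 1 = ((y + n + 1 : ℕ) : ℤ) := by push_cast; ring
  have e6 : ρ * (σ * q ^ x / ρ) = σ * q ^ x := by field_simp
  have e7 : qpoch (σ * q ^ (x + 1) / ρ) q (y + n) =
      qpoch (σ * q ^ (x + 1) / ρ) q y * qpoch (σ * q ^ (x + y + 1) / ρ) q n := by
    rw [qpoch_add]
    congr 2
    ring
  have e8 : σ * q ^ x / ρ * q = σ * q ^ (x + 1) / ρ := by ring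
  have n1 := qpoch_self_ne_zero hq1 x
  have n2 := qpoch_self_ne_zero hq1 y
  have n3 := qpoch_self_ne_zero hq1 n
  have n4 := qpoch_self_ne_zero hq1 (y + n)
  have n5 : qpoch (ρ * q) q y ≠ 0 := by
    simpa using qpoch_mul_pow_ne_zero (a := ρ) (q := q) (m := 1) (n := y)
      fun k h1 h2 => hρ k h1 (by omega)
  have n6 : qpoch (σ * q ^ (x + y + 1)) q y ≠ 0 :=
    qpoch_mul_pow_ne_zero fun k h1 h2 => hσ k (by omega) (by omega)
  have n7 : qpoch (σ * q ^ (x + 2 * y + 2)) q n ≠ 0 :=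
    qpoch_mul_pow_ne_zero fun k h1 h2 => hσ k (by omega) (by omega)
  have n8 : qpoch (σ * q ^ (x + 1) / ρ) q y ≠ 0 := by
    rw [mul_div_right_comm]
    refine qpoch_mul_pow_ne_zero fun k h1 h2 h => hσρ k (by omega) (by omega) ?_
    field_simp at h
    exact h
  have n9 : qpoch (q ^ (y + n + 1) * s / r) q x ≠ 0 := by
    rw [show q ^ (y + n + 1) * s / r = s / r * q ^ (y + n + 1) by ring]
    refine qpoch_mul_pow_ne_zero fun k h1 h2 h => hsr k (by omega) (by omega) ?_
    field_simp at h
    exact h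
  rw [qwF, qtrinom, qwFx, qhahnNorm, e2, e1, e4, e5, zpow_natCast, e6, e7, e8,
    eq_div_of_mul_eq hz1 ((mul_comm _ _).trans R1), eq_div_of_mul_eq hz2 ((mul_comm _ _).trans R2),
    show σ * q ^ x * q ^ (y + 1) = σ * q ^ (x + y + 1) by ring,
    show σ * q ^ x * q ^ (2 * y + 2) = σ * q ^ (x + 2 * y + 2) by ring, div_pow (σ * _)]
  generalize qpoch (σ * q ^ (x + y + 1)) q y = u1 at *
  generalize qpoch (σ * q ^ (x + 2 * y + 2)) q n = u2 at *
  generalize qpoch (σ * q ^ (x + 1) / ρ) q y = u3 at *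
  generalize qpoch (σ * q ^ (x + y + 1) / ρ) q n = u4 at *
  generalize qpoch (ρ * q) q y = u5 at *
  generalize qpoch (q ^ (y + n + 1) * s / r) q x = u6 at *
  generalize q ^ n.choose 2 = u7 at *
  have n10 := right_ne_zero_of_mul hz1
  clear R1 R2 hz1 hz2 e7
  field_simp
  ring

/-- The factor relating the sum over `y` to a `q`-Hahn weight in `x`. -/
noncomputable def qTratnikFactor (N : ℕ) (q r s ρ σ : ℂ) (j : ℕ) : ℂ :=
  (-1) ^ N * qpoch q q N * qpoch (σ * q ^ (N - j + 1) / ρ) q j * (ρ * q) ^ j /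
    (qpoch q q j * qpoch (ρ * q) q j * qpoch (s * q ^ (j + 1) / r) q (N - j))

lemma qbinom_sq_mul_qwFx {q r s ρ σ : ℂ} {N x j : ℕ} (hxj : x + j ≤ N) (hq0 : q ≠ 0)
    (hr0 : r ≠ 0) (hρ0 : ρ ≠ 0) (hq1 : ∀ m : ℕ, 1 ≤ m → q ^ m ≠ 1)
    (hρ : ∀ m : ℕ, 1 ≤ m → m ≤ N + 1 → ρ * q ^ m ≠ 1)
    (hsr : ∀ m : ℕ, 1 ≤ m → m ≤ 2 * N → s * q ^ m ≠ r)
    (hσρ : ∀ m : ℕ, 1 ≤ m → m ≤ 2 * N → σ * q ^ m ≠ ρ) :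
    qbinom q (N - x) j ^ 2 * qwFx N q r s ρ σ x *
        (qhahnWeight q ρ (σ * q ^ x / ρ) (N - x) j)⁻¹ =
      qTratnikFactor N q r s ρ σ j * qhahnWeight q r (s * q ^ j / r) (N - j) x := by
  obtain ⟨n, rfl⟩ := Nat.exists_eq_add_of_le hxj
  have e1 : x + j + n - x = n + j := by omega
  have e2 : x + j + n - j = n + x := by omega
  have e3 : n + j - j = n := by omega
  have e4 : n + x - x = n := by omega
  have e5 : σ * q ^ x / ρ * q = σ * q ^ (x + 1) / ρ := by ring
  have e6 : s * q ^ j / r * q = s * q ^ (j + 1) / r := by ring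
  have e7 : qpoch (σ * q ^ (x + 1) / ρ) q (n + j) =
      qpoch (σ * q ^ (x + 1) / ρ) q n * qpoch (σ * q ^ (n + x + 1) / ρ) q j := by
    rw [qpoch_add]
    congr 2
    ring
  have e8 : qpoch (s * q ^ (j + 1) / r) q (n + x) =
      qpoch (s * q ^ (j + 1) / r) q n * qpoch (q ^ (n + j + 1) * s / r) q x := by
    rw [qpoch_add]
    congr 2
    ring
  have n1 := qpoch_self_ne_zero hq1 x
  have n2 := qpoch_self_ne_zero hq1 j
  have n3 := qpoch_self_ne_zero hq1 n
  have n4 := qpoch_self_ne_zero hq1 (n + j)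
  have n5 : qpoch (ρ * q) q j ≠ 0 := by
    simpa using qpoch_mul_pow_ne_zero (a := ρ) (q := q) (m := 1) (n := j)
      fun k h1 h2 => hρ k h1 (by omega)
  have n6 : qpoch (σ * q ^ (x + 1) / ρ) q n ≠ 0 := by
    rw [mul_div_right_comm]
    refine qpoch_mul_pow_ne_zero fun k h1 h2 h => hσρ k (by omega) (by omega) ?_
    field_simp at h
    exact h
  have n7 : qpoch (s * q ^ (j + 1) / r) q (n + x) ≠ 0 := by
    rw [mul_div_right_comm]
    refine qpoch_mul_pow_ne_zero fun k h1 h2 h => hsr k (by omega) (by omega) ?_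
    field_simp at h
    exact h
  rw [e8] at n7
  have n8 := left_ne_zero_of_mul n7
  have n9 := right_ne_zero_of_mul n7
  rw [qwFx, qTratnikFactor, qhahnWeight, qhahnWeight, e1, e2, e3, e4, e5, e6, e7, e8, qbinom,
    if_pos (by omega), e3]
  generalize qpoch (σ * q ^ (x + 1) / ρ) q n = u1 at *
  generalize qpoch (σ * q ^ (n + x + 1) / ρ) q j = u2 at *
  generalize qpoch (s * q ^ (j + 1) / r) q n = u3 at *
  generalize qpoch (q ^ (n + j + 1) * s / r) q x = u4 at *
  generalize qpoch (ρ * q) q j = u5 at *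
  clear e7 e8
  field_simp

/-- The normalization of `T_{i,j}(x,y)` that does not depend on `x` and `y`. -/
noncomputable def qTratnikCoeff (N : ℕ) (q r s ρ σ : ℂ) (i j : ℕ) : ℂ :=
  (-1 : ℂ) ^ j * q ^ (((j : ℤ) * ((j : ℤ) - 3 - 2 * (N : ℤ))) / 2) * qbinom q (N - j) i *
      (qpoch (r * q) q i * qpoch (s * q ^ (j + 2)) q (N - j) * qpoch (ρ * q) q j) /
    ((r * q) ^ i * qpoch (s * q ^ (j + 1) / r) q i * qpoch (s * q ^ (i + j + 1)) q i *
      qpoch (s * q ^ (2 * i + j + 2)) q (N - i - j) * σ ^ j *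
      qpoch (q ^ (-(N : ℤ)) * ρ / σ) q j)

lemma qTratnikT_eq {q : ℂ} (hq : q ≠ 0) (r s ρ σ : ℂ) {N i j x y : ℕ} (hij : i + j ≤ N)
    (hxy : x + y ≤ N) :
    qTratnikT N q r s ρ σ i j x y = qTratnikCoeff N q r s ρ σ i j * qbinom q (N - x) j *
      qhahn q r (s * q ^ j) (N - j) i x * qhahn q ρ (σ * q ^ x) (N - x) y j := by
  rw [qTratnikT, qTratnikCoeff, qphi_eq_qhahn hq r s x hij, qphi'_eq_qhahn hq ρ σ j hxy]
  ring

lemma two_mul_cast_choose_two (n : ℕ) : 2 * (n.choose 2 : ℤ) = n * (n - 1) := by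
  induction n with
  | zero => simp
  | succ n ih =>
    rw [Nat.choose_succ_succ' n 1, Nat.choose_one_right]
    push_cast
    linear_combination ih

lemma qwG_eq {q r s ρ σ : ℂ} {N i j : ℕ} (hij : i + j ≤ N) (hq0 : q ≠ 0) (hr0 : r ≠ 0)
    (hs0 : s ≠ 0) (hρ0 : ρ ≠ 0) (hσ0 : σ ≠ 0) (hq1 : ∀ m : ℕ, 1 ≤ m → q ^ m ≠ 1)
    (hr : ∀ m : ℕ, 1 ≤ m → m ≤ N + 1 → r * q ^ m ≠ 1)
    (hρ : ∀ m : ℕ, 1 ≤ m → m ≤ N + 1 → ρ * q ^ m ≠ 1)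
    (hs : ∀ m : ℕ, 1 ≤ m → m ≤ 2 * N + 2 → s * q ^ m ≠ 1)
    (hsr : ∀ m : ℕ, 1 ≤ m → m ≤ 2 * N → s * q ^ m ≠ r)
    (hσρ : ∀ m : ℕ, 1 ≤ m → m ≤ 2 * N → σ * q ^ m ≠ ρ) :
    qTratnikCoeff N q r s ρ σ i j ^ 2 * qTratnikFactor N q r s ρ σ j *
      qhahnNorm q r (s * q ^ j / r) (N - j) i = qwG N q r s ρ σ i j := by
  obtain ⟨n, rfl⟩ := Nat.exists_eq_add_of_le hij
  have R1 := qpoch_reverse (z := σ * q ^ (i + n + 1) / ρ)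
    (w := q ^ (-((i + j + n : ℕ) : ℤ)) * ρ / σ) hq0 j (by
      rw [zpow_neg, zpow_natCast]
      field_simp
      ring)
  have R2 := qpoch_reverse (z := s * q ^ (j + 1) / r)
    (w := r * q ^ (-((i + j + n : ℕ) : ℤ)) / s) hq0 (i + n) (by
      rw [zpow_neg, zpow_natCast]
      field_simp
      ring)
  have n7 : qpoch (s * q ^ (j + 1) / r) q (i + n) ≠ 0 := by
    rw [mul_div_right_comm]
    refine qpoch_mul_pow_ne_zero fun k h1 h2 h => hsr k (by omega) (by omega) ?_
    field_simp at h
    exact h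
  have n8 : qpoch (s * q ^ (j + 1) / r) q i ≠ 0 := by
    rw [qpoch_add] at n7
    exact left_ne_zero_of_mul n7
  have n9 : qpoch (σ * q ^ (i + n + 1) / ρ) q j ≠ 0 := by
    rw [mul_div_right_comm]
    refine qpoch_mul_pow_ne_zero fun k h1 h2 h => hσρ k (by omega) (by omega) ?_
    field_simp at h
    exact h
  have n10 : qpoch (ρ * q) q j ≠ 0 := by
    simpa using qpoch_mul_pow_ne_zero (a := ρ) (q := q) (m := 1) (n := j)
      fun k h1 h2 => hρ k h1 (by omega)
  have n11 : qpoch (r * q) q i ≠ 0 := by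
    simpa using qpoch_mul_pow_ne_zero (a := r) (q := q) (m := 1) (n := i)
      fun k h1 h2 => hr k h1 (by omega)
  have n12 : qpoch (s * q ^ (i + j + 1)) q i ≠ 0 :=
    qpoch_mul_pow_ne_zero fun k h1 h2 => hs k (by omega) (by omega)
  have n13 : qpoch (s * q ^ (2 * i + j + 2)) q n ≠ 0 :=
    qpoch_mul_pow_ne_zero fun k h1 h2 => hs k (by omega) (by omega)
  have hz1 : (σ * q ^ (i + n + 1) / ρ) ^ j * q ^ j.choose 2 ≠ 0 := by simp [hσ0, hq0, hρ0]
  have hz2 : (s * q ^ (j + 1) / r) ^ (i + n) * q ^ (i + n).choose 2 ≠ 0 := by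
    simp [hs0, hq0, hr0]
  have e1 : i + j + n - j = i + n := by omega
  have e2 : i + j + n - i - j = n := by omega
  have e3 : i + n - i = n := by omega
  have e4 : r * (s * q ^ j / r) = s * q ^ j := by field_simp
  have e5 : s * q ^ j / r * q = s * q ^ (j + 1) / r := by ring
  have n1 := qpoch_self_ne_zero hq1 i
  have n2 := qpoch_self_ne_zero hq1 j
  have n3 := qpoch_self_ne_zero hq1 n
  have n4 := qpoch_self_ne_zero hq1 (i + n)
  have e6 : q ^ (((j : ℤ) * ((j : ℤ) - 3 - 2 * ((i + j + n : ℕ) : ℤ))) / 2) =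
      q ^ j.choose 2 / q ^ (j + j * (i + j + n)) := by
    rw [Int.ediv_eq_of_eq_mul_right (c := (j.choose 2 : ℤ) - ((j + j * (i + j + n) : ℕ) : ℤ))
      two_ne_zero (by push_cast; linear_combination -two_mul_cast_choose_two j), zpow_sub₀ hq0,
      zpow_natCast, zpow_natCast]
  have e7 : q ^ ((-((i + j + n : ℕ) : ℤ) * (((i + j + n : ℕ) : ℤ) + 3)) / 2) =
      (q ^ ((i + n).choose 2 + j.choose 2 + (i + n) * j + 2 * (i + j + n)))⁻¹ := by
    rw [Int.ediv_eq_of_eq_mul_right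
      (c := -(((i + n).choose 2 + j.choose 2 + (i + n) * j + 2 * (i + j + n) : ℕ) : ℤ))
      two_ne_zero (by
        have h := two_mul_cast_choose_two (i + n)
        push_cast at h ⊢
        linear_combination two_mul_cast_choose_two j + h), zpow_neg, zpow_natCast]
  rw [qTratnikCoeff, qTratnikFactor, qhahnNorm, qwG, e6, e7, qtrinom, qbinom, e1,
    if_pos (by omega), e2, e3, e4, e5, show s * q ^ j * q ^ (i + 1) = s * q ^ (i + j + 1) by ring,
    show s * q ^ j * q ^ (2 * i + 2) = s * q ^ (2 * i + j + 2) by ring,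
    show ρ * q ^ (-((i + j + n : ℕ) : ℤ)) / σ = q ^ (-((i + j + n : ℕ) : ℤ)) * ρ / σ by ring,
    eq_div_of_mul_eq hz1 ((mul_comm _ _).trans R1), eq_div_of_mul_eq hz2 ((mul_comm _ _).trans R2),
    div_pow (σ * _), div_pow (s * _), mul_pow σ, mul_pow s]
  have hv : (q ^ j.choose 2) ^ 2 = q ^ (j * j) / q ^ j := by
    rw [eq_div_iff (pow_ne_zero _ hq0), ← pow_mul, ← pow_add]
    congr 1
    zify
    linear_combination two_mul_cast_choose_two j
  generalize qpoch (σ * q ^ (i + n + 1) / ρ) q j = u1 at *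
  generalize qpoch (s * q ^ (j + 1) / r) q (i + n) = u2 at *
  generalize qpoch (s * q ^ (j + 1) / r) q i = u3 at *
  generalize qpoch (s * q ^ (i + j + 1)) q i = u4 at *
  generalize qpoch (s * q ^ (2 * i + j + 2)) q n = u5 at *
  generalize qpoch (ρ * q) q j = u6 at *
  generalize qpoch (r * q) q i = u7 at *
  have n5 : q ^ j.choose 2 ≠ 0 := pow_ne_zero _ hq0
  have n6 : q ^ (i + n).choose 2 ≠ 0 := pow_ne_zero _ hq0
  rw [pow_add q ((i + n).choose 2 + j.choose 2 + (i + n) * j),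
    pow_add q ((i + n).choose 2 + j.choose 2), pow_add q ((i + n).choose 2)]
  generalize q ^ j.choose 2 = v1 at *
  generalize q ^ (i + n).choose 2 = v2 at *
  clear R1 R2 hz1 hz2 e6 e7
  have hsq : ((-1 : ℂ) ^ j) ^ 2 = 1 := by rw [← pow_mul, mul_comm, pow_mul]; simp
  have hsg : (-1 : ℂ) ^ (i + j + n) = (-1) ^ j * (-1) ^ (i + n) := by ring
  rw [hsg]
  have n14 : (-1 : ℂ) ^ j ≠ 0 := by simp
  have n15 : (-1 : ℂ) ^ (i + n) ≠ 0 := by simp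
  generalize (-1 : ℂ) ^ j = g1 at *
  have hsq2 : ((-1 : ℂ) ^ (i + n)) ^ 2 = 1 := by rw [← pow_mul, mul_comm, pow_mul]; simp
  generalize (-1 : ℂ) ^ (i + n) = g2 at *
  have hv4 : v1 ^ 4 = (q ^ (j * j) / q ^ j) ^ 2 := by rw [← hv]; ring
  field_simp
  rw [hsq, hsq2, hv4]
  field_simp
  ring

theorem qTratnik_orthogonality (N : ℕ) (hN : 0 < N) (q r s ρ σ : ℂ)
    (hq0 : q ≠ 0) (hr0 : r ≠ 0) (hs0 : s ≠ 0) (hρ0 : ρ ≠ 0) (hσ0 : σ ≠ 0)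
    (hq1 : ∀ m : ℕ, 1 ≤ m → q ^ m ≠ 1)
    (hr : ∀ m : ℕ, 1 ≤ m → m ≤ N + 1 → r * q ^ m ≠ 1)
    (hρ : ∀ m : ℕ, 1 ≤ m → m ≤ N + 1 → ρ * q ^ m ≠ 1)
    (hs : ∀ m : ℕ, 1 ≤ m → m ≤ 2 * N + 2 → s * q ^ m ≠ 1)
    (hσ : ∀ m : ℕ, 1 ≤ m → m ≤ 2 * N + 2 → σ * q ^ m ≠ 1)
    (hsr : ∀ m : ℕ, 1 ≤ m → m ≤ 2 * N → s * q ^ m ≠ r)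
    (hσρ : ∀ m : ℕ, 1 ≤ m → m ≤ 2 * N → σ * q ^ m ≠ ρ)
    (i j i' j' : ℕ) (hij : i + j ≤ N) (hij' : i' + j' ≤ N) :
    ∑ x ∈ Finset.range (min (N - j) (N - j') + 1), ∑ y ∈ Finset.range (N - x + 1),
        qwF N q r s ρ σ x y * qTratnikT N q r s ρ σ i j x y * qTratnikT N q r s ρ σ i' j' x y =
      if i = i' ∧ j = j' then qwG N q r s ρ σ i j else 0 := by
  have inner : ∀ x ∈ Finset.range (min (N - j) (N - j') + 1),
      ∑ y ∈ Finset.range (N - x + 1),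
        qwF N q r s ρ σ x y * qTratnikT N q r s ρ σ i j x y * qTratnikT N q r s ρ σ i' j' x y =
      qTratnikCoeff N q r s ρ σ i j * qTratnikCoeff N q r s ρ σ i' j' *
        (qbinom q (N - x) j * qbinom q (N - x) j' * qwFx N q r s ρ σ x) *
        (qhahn q r (s * q ^ j) (N - j) i x * qhahn q r (s * q ^ j') (N - j') i' x) *
        if j = j' then (qhahnWeight q ρ (σ * q ^ x / ρ) (N - x) j)⁻¹ else 0 := by
    intro x hx
    rw [Finset.mem_range] at hx
    have e : ρ * (σ * q ^ x / ρ) = σ * q ^ x := by field_simp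
    rw [← qhahn_dual_orthogonality (M := N - x) (a := ρ) (b := σ * q ^ x / ρ) hq0 hq1 hρ0
      (by simp [hσ0, hq0, hρ0]) (fun m h1 h2 => hρ m h1 (by omega))
      (fun m h1 h2 h => hσρ (x + m) (by omega) (by omega) (by
        field_simp at h
        rw [pow_add, ← mul_assoc, h]))
      (fun m h1 h2 => by
        rw [e, mul_assoc, ← pow_add]
        exact hσ (x + m) (by omega) (by omega))
      (by omega) (by omega), Finset.mul_sum]
    refine Finset.sum_congr rfl fun y hy => ?_
    rw [Finset.mem_range] at hy
    have hxy : x + y ≤ N := by omega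
    rw [qwF_eq s hxy hq0 hr0 hρ0 hσ0 hq1 hρ hσ hsr hσρ, qTratnikT_eq hq0 r s ρ σ hij hxy,
      qTratnikT_eq hq0 r s ρ σ hij' hxy, e]
    ring
  rw [Finset.sum_congr rfl inner]
  rcases eq_or_ne j j' with rfl | hj
  · have e : r * (s * q ^ j / r) = s * q ^ j := by field_simp
    have key := qhahn_orthogonality (M := N - j) (a := r) (b := s * q ^ j / r) (m := i) (n := i')
      hq0 hq1 hr0 (by simp [hs0, hq0, hr0]) (fun m h1 h2 => hr m h1 (by omega))
      (fun m h1 h2 => by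
        rw [e, mul_assoc, ← pow_add]
        exact hs (j + m) (by omega) (by omega))
      (by omega) (by omega)
    rw [e] at key
    have outer : ∀ x ∈ Finset.range (N - j + 1), _ = _ := fun x hx =>
      qbinom_sq_mul_qwFx (σ := σ) (x := x) (j := j) (N := N)
        (by rw [Finset.mem_range] at hx; omega) hq0 hr0 hρ0 hq1 hρ hsr hσρ
    trans qTratnikCoeff N q r s ρ σ i j * qTratnikCoeff N q r s ρ σ i' j *
      qTratnikFactor N q r s ρ σ j *
      (if i = i' then qhahnNorm q r (s * q ^ j / r) (N - j) i' else 0)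
    · rw [← key, Finset.mul_sum, min_self]
      refine Finset.sum_congr rfl fun x hx => ?_
      rw [if_pos rfl]
      linear_combination qTratnikCoeff N q r s ρ σ i j * qTratnikCoeff N q r s ρ σ i' j *
        (qhahn q r (s * q ^ j) (N - j) i x * qhahn q r (s * q ^ j) (N - j) i' x) * outer x hx
    · rcases eq_or_ne i i' with rfl | hi
      · rw [if_pos rfl, if_pos ⟨rfl, rfl⟩,
          ← qwG_eq hij hq0 hr0 hs0 hρ0 hσ0 hq1 hr hρ hs hsr hσρ]
        ring
      · simp [hi]
  · simp [hj]
end
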